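/- arXiv:1510.01415 — 2 statements merged into one kernel-verified Lean document; each statement's English description precedes it below -/
import Mathlib

section
/- Let F and G be two finite simple graphs on the same vertex set V, and let F ∪ G denote the graph on V whose edge set is E(F) ∪ E(G). Then for every probability distribution P on V, H(F ∪ G, P) ≤ H(F,P) + H(G,P). -/
open Finset

/-- `I` is an independent set of the graph `G`. -/
def IsIndepSet {V : Type*} (G : SimpleGraph V) (I : Finset V) : Prop :=
  ∀ u ∈ I, ∀ w ∈ I, ¬ G.Adj u w

/-- The characteristic vector (in `ℝ^V`) of a finite set of vertices. -/
def charVec {V : Type*} [DecidableEq V] (I : Finset V) : V → ℝ :=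
  fun v => if v ∈ I then 1 else 0

/-- The vertex packing polytope `VP(G)`: the convex hull of the characteristic
vectors of the independent sets of `G`. -/
def vertexPacking {V : Type*} [Fintype V] [DecidableEq V] (G : SimpleGraph V) : Set (V → ℝ) :=
  convexHull ℝ {x | ∃ I : Finset V, IsIndepSet G I ∧ x = charVec I}

/-- `P` is a probability distribution on the (finite) vertex set `V`. -/
def IsProbDist {V : Type*} [Fintype V] (P : V → ℝ) : Prop :=
  (∀ v, 0 ≤ P v) ∧ ∑ v, P v = 1

/-- The entropy of the graph `G` with respect to `P`:
`H(G,P) = min_{a ∈ VP(G)} ∑_v p_v · log₂(1/a_v)`, where (by the convention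
`0 · log₂(1/0) = 0`) coordinates with `p_v = 0` are irrelevant and the minimum
is never achieved with `a_v = 0` at a coordinate with `p_v > 0`; accordingly the
minimization is over points of `VP(G)` that are positive on the support of `P`. -/
noncomputable def graphEntropy {V : Type*} [Fintype V] [DecidableEq V]
    (G : SimpleGraph V) (P : V → ℝ) : ℝ :=
  sInf { x | ∃ a ∈ vertexPacking G, (∀ v, 0 < P v → 0 < a v) ∧
      x = ∑ v, P v * Real.logb 2 (1 / a v) }

/-- The fractional chromatic number of `G`: the minimum of `∑_I w_I` over
nonnegative weight functions on the independent sets of `G` such that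
`∑_{I ∋ v} w_I ≥ 1` for every vertex `v`. -/
noncomputable def fracChromatic {V : Type*} [Fintype V] [DecidableEq V]
    (G : SimpleGraph V) : ℝ :=
  sInf { x | ∃ w : Finset V → ℝ, (∀ I, 0 ≤ w I) ∧ (∀ I, w I ≠ 0 → IsIndepSet G I) ∧
      (∀ v : V, 1 ≤ ∑ I ∈ Finset.univ.filter (fun I : Finset V => v ∈ I), w I) ∧
      x = ∑ I : Finset V, w I }

/-- The independence number `α(G)`. -/
noncomputable def indepNum {V : Type*} [Fintype V] (G : SimpleGraph V) : ℕ :=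
  sSup {n | ∃ I : Finset V, IsIndepSet G I ∧ I.card = n}

/-- `I` is a maximum weighted independent set of `G` with respect to `P`. -/
def IsMaxWeightIndep {V : Type*} [Fintype V] (G : SimpleGraph V) (P : V → ℝ)
    (I : Finset V) : Prop :=
  IsIndepSet G I ∧ ∀ J : Finset V, IsIndepSet G J → ∑ v ∈ J, P v ≤ ∑ v ∈ I, P v

/-- A multiset `S` of (independent) sets uniformly covers `W` if every vertex of `W`
belongs to exactly the same (positive) number of members of `S`, counted with
multiplicity. -/
def UniformOver {V : Type*} [DecidableEq V] (S : Multiset (Finset V)) (W : Set V) : Prop :=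
  ∃ c : ℕ, 0 < c ∧ ∀ v ∈ W, (S.filter (fun I => v ∈ I)).card = c

/-- `G` is symmetric with respect to graph entropy: the uniform distribution
maximizes `H(G, ·)`. -/
def EntropySymmetric {V : Type*} [Fintype V] [DecidableEq V] (G : SimpleGraph V) : Prop :=
  ∀ P : V → ℝ, IsProbDist P →
    graphEntropy G P ≤ graphEntropy G (fun _ => (1 : ℝ) / Fintype.card V)

lemma charVec_mul_charVec {V : Type*} [DecidableEq V] (I J : Finset V) :
    charVec I * charVec J = charVec (I ∩ J) := by
  ext v
  by_cases hI : v ∈ I <;> by_cases hJ : v ∈ J <;> simp [charVec, hI, hJ]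

lemma IsIndepSet.inter_sup {V : Type*} [DecidableEq V] {F G : SimpleGraph V} {I J : Finset V}
    (hI : IsIndepSet F I) (hJ : IsIndepSet G J) : IsIndepSet (F ⊔ G) (I ∩ J) := by
  intro u hu w hw h
  rw [Finset.mem_inter] at hu hw
  rcases h with h | h
  · exact hI u hu.1 w hw.1 h
  · exact hJ u hu.2 w hw.2 h

/-- The coordinatewise product of points of `VP(F)` and `VP(G)` lies in `VP(F ∪ G)`. -/
lemma mul_mem_vertexPacking_sup {V : Type*} [Fintype V] [DecidableEq V] {F G : SimpleGraph V}
    {a b : V → ℝ} (ha : a ∈ vertexPacking F) (hb : b ∈ vertexPacking G) :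
    a * b ∈ vertexPacking (F ⊔ G) := by
  have hconv : Convex ℝ (vertexPacking (F ⊔ G)) := convex_convexHull ℝ _
  have hchar : ∀ I, IsIndepSet F I → charVec I * b ∈ vertexPacking (F ⊔ G) := by
    intro I hI
    refine convexHull_min (t := LinearMap.mulLeft ℝ (charVec I) ⁻¹' vertexPacking (F ⊔ G))
      ?_ (hconv.linear_preimage _) hb
    rintro _ ⟨J, hJ, rfl⟩
    exact subset_convexHull ℝ _ ⟨I ∩ J, hI.inter_sup hJ, charVec_mul_charVec I J⟩
  refine convexHull_min (t := LinearMap.mulRight ℝ b ⁻¹' vertexPacking (F ⊔ G))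
    ?_ (hconv.linear_preimage _) ha
  rintro _ ⟨I, hI, rfl⟩
  exact hchar I hI

lemma le_one_of_mem_vertexPacking {V : Type*} [Fintype V] [DecidableEq V] {G : SimpleGraph V}
    {a : V → ℝ} (ha : a ∈ vertexPacking G) : a ≤ 1 := by
  refine convexHull_min (t := Set.Iic (1 : V → ℝ)) ?_ (convex_Iic _) ha
  rintro _ ⟨I, -, rfl⟩ v
  by_cases h : v ∈ I <;> simp [charVec, h]

lemma exists_pos_mem_vertexPacking {V : Type*} [Fintype V] [DecidableEq V] [Nonempty V]
    (G : SimpleGraph V) : ∃ a ∈ vertexPacking G, ∀ v, 0 < a v := by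
  refine ⟨∑ u : V, (Fintype.card V : ℝ)⁻¹ • charVec {u}, ?_, ?_⟩
  · refine (convex_convexHull ℝ _).sum_mem (fun _ _ => by positivity) (by simp) fun u _ => ?_
    refine subset_convexHull ℝ _ ⟨{u}, ?_, rfl⟩
    intro x hx y hy
    rw [Finset.mem_singleton] at hx hy
    subst hx hy
    exact G.irrefl
  · intro v
    simp [charVec, Fintype.card_pos]

lemma bddBelow_graphEntropy {V : Type*} [Fintype V] [DecidableEq V] (G : SimpleGraph V)
    {P : V → ℝ} (hP : ∀ v, 0 ≤ P v) :
    BddBelow { x | ∃ a ∈ vertexPacking G, (∀ v, 0 < P v → 0 < a v) ∧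
      x = ∑ v, P v * Real.logb 2 (1 / a v) } := by
  refine ⟨0, ?_⟩
  rintro _ ⟨a, ha, hpos, rfl⟩
  refine Finset.sum_nonneg fun v _ => ?_
  rcases (hP v).eq_or_lt with h | h
  · simp [← h]
  · exact mul_nonneg h.le (Real.logb_nonneg one_lt_two
      ((one_le_div (hpos v h)).2 (le_one_of_mem_vertexPacking ha v)))

lemma nonempty_graphEntropy {V : Type*} [Fintype V] [DecidableEq V] [Nonempty V]
    (G : SimpleGraph V) (P : V → ℝ) :
    { x | ∃ a ∈ vertexPacking G, (∀ v, 0 < P v → 0 < a v) ∧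
      x = ∑ v, P v * Real.logb 2 (1 / a v) }.Nonempty := by
  obtain ⟨a, ha, hpos⟩ := exists_pos_mem_vertexPacking G
  exact ⟨_, a, ha, fun v _ => hpos v, rfl⟩

/-- Sub-additivity of graph entropy with respect to graph union:
`H(F ∪ G, P) ≤ H(F,P) + H(G,P)`. -/
theorem graphEntropy_union_le
    {V : Type*} [Fintype V] [DecidableEq V] (F G : SimpleGraph V)
    (P : V → ℝ) (hP : IsProbDist P) :
    graphEntropy (F ⊔ G) P ≤ graphEntropy F P + graphEntropy G P := by
  have : Nonempty V := by
    by_contra h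
    rw [not_nonempty_iff] at h
    simpa using hP.2
  suffices h : graphEntropy (F ⊔ G) P - graphEntropy G P ≤ graphEntropy F P by linarith
  refine le_csInf (nonempty_graphEntropy F P) ?_
  rintro _ ⟨a, ha, hapos, rfl⟩
  suffices h : graphEntropy (F ⊔ G) P - ∑ v, P v * Real.logb 2 (1 / a v) ≤ graphEntropy G P by
    linarith
  refine le_csInf (nonempty_graphEntropy G P) ?_
  rintro _ ⟨b, hb, hbpos, rfl⟩
  rw [sub_le_iff_le_add', ← Finset.sum_add_distrib]
  refine csInf_le (bddBelow_graphEntropy (F ⊔ G) hP.1) ⟨a * b, mul_mem_vertexPacking_sup ha hb,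
    fun v hv => mul_pos (hapos v hv) (hbpos v hv), Finset.sum_congr rfl fun v _ => ?_⟩
  rcases (hP.1 v).eq_or_lt with h | h
  · simp [← h]
  · have ha0 := (hapos v h).ne'
    have hb0 := (hbpos v h).ne'
    rw [← mul_add, ← Real.logb_mul (one_div_ne_zero ha0) (one_div_ne_zero hb0),
      one_div_mul_one_div, Pi.mul_apply]
end

section
/- Let G be a finite simple graph on n vertices with χ_f(G) = n/α(G). Then H(G,U) = log₂ χ_f(G) = log₂(n/α(G)), where U is the uniform distribution on V(G). In particular, for every point x in the vertex packing polytope VP(G), −(1/n)·Σ_{v∈V(G)} log₂ x_v ≥ log₂ χ_f(G). -/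
open Finset

lemma IsIndepSet.card_le_indepNum {V : Type*} [Fintype V] {G : SimpleGraph V} {I : Finset V}
    (hI : IsIndepSet G I) : I.card ≤ indepNum G :=
  le_csSup ⟨Fintype.card V, by rintro _ ⟨J, -, rfl⟩; exact J.card_le_univ⟩ ⟨I, hI, rfl⟩

lemma indepNum_pos {V : Type*} [Fintype V] [Nonempty V] (G : SimpleGraph V) :
    0 < indepNum G := by
  have hI : IsIndepSet G {Classical.arbitrary V} := by
    intro u hu w hw
    rw [Finset.mem_singleton] at hu hw
    rw [hu, hw]
    exact G.loopless.irrefl _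
  exact Nat.lt_of_lt_of_le (by simp) hI.card_le_indepNum

lemma sum_le_indepNum_of_mem_vertexPacking {V : Type*} [Fintype V] [DecidableEq V]
    {G : SimpleGraph V} {x : V → ℝ} (hx : x ∈ vertexPacking G) :
    ∑ v, x v ≤ (indepNum G : ℝ) := by
  have hconv : Convex ℝ {y : V → ℝ | ∑ v, y v ≤ (indepNum G : ℝ)} := by
    refine convex_halfSpace_le (f := fun y : V → ℝ => ∑ v, y v) ⟨?_, ?_⟩ _
    · intro y z
      simp [Finset.sum_add_distrib]
    · intro c y
      simp [Finset.mul_sum]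
  refine convexHull_min ?_ hconv hx
  rintro _ ⟨I, hI, rfl⟩
  simpa [charVec] using hI.card_le_indepNum

/-- By concavity of the logarithm, the uniform entropy functional is at least `log₂ (n / α(G))`
on the positive part of the vertex packing polytope. -/
lemma logb_card_div_indepNum_le {V : Type*} [Fintype V] [DecidableEq V] [Nonempty V]
    {G : SimpleGraph V} {x : V → ℝ} (hx : x ∈ vertexPacking G) (hpos : ∀ v, 0 < x v) :
    Real.logb 2 ((Fintype.card V : ℝ) / (indepNum G : ℝ)) ≤
      -(1 / (Fintype.card V : ℝ)) * ∑ v, Real.logb 2 (x v) := by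
  have hn : (0 : ℝ) < Fintype.card V := by exact_mod_cast Fintype.card_pos
  have hα : (0 : ℝ) < indepNum G := by exact_mod_cast indepNum_pos G
  have hjensen : ∑ v, (1 / (Fintype.card V : ℝ)) • Real.log (x v) ≤
      Real.log (∑ v, (1 / (Fintype.card V : ℝ)) • x v) :=
    strictConcaveOn_log_Ioi.concaveOn.le_map_sum (fun _ _ => by positivity)
      (by simp [hn.ne']) (fun v _ => hpos v)
  simp only [smul_eq_mul, ← Finset.mul_sum] at hjensen
  have hsum : 0 < ∑ v, x v := Finset.sum_pos (fun v _ => hpos v) Finset.univ_nonempty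
  have hmono : Real.log (1 / (Fintype.card V : ℝ) * ∑ v, x v) ≤
      Real.log ((Fintype.card V : ℝ) / (indepNum G : ℝ))⁻¹ := by
    refine Real.log_le_log (by positivity) ?_
    rw [inv_div, one_div, inv_mul_eq_div]
    gcongr
    exact sum_le_indepNum_of_mem_vertexPacking hx
  rw [Real.log_inv] at hmono
  simp only [Real.logb, ← Finset.sum_div]
  rw [mul_div_assoc', div_le_div_iff_of_pos_right (Real.log_pos one_lt_two)]
  linarith

/-- A fractional colouring, scaled to total weight one, is a point of the vertex packing polytope
with all coordinates at least the inverse of its total weight. -/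
lemma exists_mem_vertexPacking_of_cover {V : Type*} [Fintype V] [DecidableEq V]
    {G : SimpleGraph V} {w : Finset V → ℝ} (hw : ∀ I, 0 ≤ w I)
    (hind : ∀ I, w I ≠ 0 → IsIndepSet G I)
    (hcov : ∀ v : V, 1 ≤ ∑ I ∈ Finset.univ.filter (fun I : Finset V => v ∈ I), w I)
    (hT : 0 < ∑ I, w I) :
    ∃ a ∈ vertexPacking G, ∀ v, 1 / ∑ I, w I ≤ a v := by
  refine ⟨(Finset.univ.filter fun I => w I ≠ 0).centerMass w charVec, ?_, fun v => ?_⟩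
  · refine Finset.centerMass_mem_convexHull _ (fun I _ => hw I) ?_ fun I hI => ?_
    · rwa [Finset.sum_filter_ne_zero]
    · exact ⟨I, hind I (Finset.mem_filter.mp hI).2, rfl⟩
  · rw [Finset.centerMass_filter_ne_zero, Finset.centerMass, Pi.smul_apply, Finset.sum_apply,
      smul_eq_mul, one_div]
    refine le_mul_of_one_le_right (by positivity) ?_
    simpa [charVec, Finset.sum_filter] using hcov v

/-- The uniform distribution has entropy at most `log₂ T` when there is a fractional colouring
of total weight `T`. -/
lemma graphEntropy_uniform_le_logb_of_cover {V : Type*} [Fintype V] [DecidableEq V] [Nonempty V]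
    {G : SimpleGraph V} {w : Finset V → ℝ} (hw : ∀ I, 0 ≤ w I)
    (hind : ∀ I, w I ≠ 0 → IsIndepSet G I)
    (hcov : ∀ v : V, 1 ≤ ∑ I ∈ Finset.univ.filter (fun I : Finset V => v ∈ I), w I)
    (hT : 0 < ∑ I, w I)
    (hbdd : BddBelow {x | ∃ a ∈ vertexPacking G,
      (∀ v, 0 < 1 / (Fintype.card V : ℝ) → 0 < a v) ∧
      x = ∑ v, 1 / (Fintype.card V : ℝ) * Real.logb 2 (1 / a v)}) :
    graphEntropy G (fun _ => (1 : ℝ) / (Fintype.card V : ℝ)) ≤ Real.logb 2 (∑ I, w I) := by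
  obtain ⟨a, ha, hle⟩ := exists_mem_vertexPacking_of_cover hw hind hcov hT
  have hpos : ∀ v, 0 < a v := fun v => (one_div_pos.mpr hT).trans_le (hle v)
  have hn : (0 : ℝ) < Fintype.card V := by exact_mod_cast Fintype.card_pos
  refine (csInf_le hbdd ⟨a, ha, fun v _ => hpos v, rfl⟩).trans ?_
  calc ∑ v, 1 / (Fintype.card V : ℝ) * Real.logb 2 (1 / a v)
      ≤ ∑ _v : V, 1 / (Fintype.card V : ℝ) * Real.logb 2 (∑ I, w I) := by
        gcongr with v
        · norm_num
        · exact one_div_pos.mpr (hpos v)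
        · exact (one_div_le hT (hpos v)).mp (hle v)
    _ = Real.logb 2 (∑ I, w I) := by
        simp [hn.ne']

/-- If `χ_f(G) = n / α(G)`, then `H(G,U) = log₂ χ_f(G) = log₂(n/α(G))` for the
uniform distribution `U`; in particular every strictly positive point `x` of the
vertex packing polytope satisfies `-(1/n) ∑_v log₂ x_v ≥ log₂ χ_f(G)`. -/
theorem graphEntropy_uniform_of_fracChromatic_eq_card_div_indepNum
    {V : Type*} [Fintype V] [DecidableEq V] [Nonempty V] (G : SimpleGraph V)
    (h : fracChromatic G = (Fintype.card V : ℝ) / (indepNum G : ℝ)) :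
    graphEntropy G (fun _ => (1 : ℝ) / (Fintype.card V : ℝ)) =
        Real.logb 2 (fracChromatic G) ∧
      Real.logb 2 (fracChromatic G) =
        Real.logb 2 ((Fintype.card V : ℝ) / (indepNum G : ℝ)) ∧
      ∀ x ∈ vertexPacking G, (∀ v, 0 < x v) →
        Real.logb 2 (fracChromatic G) ≤
          -(1 / (Fintype.card V : ℝ)) * ∑ v, Real.logb 2 (x v) := by
  have hn : (0 : ℝ) < Fintype.card V := by exact_mod_cast Fintype.card_pos
  have hα : (0 : ℝ) < indepNum G := by exact_mod_cast indepNum_pos G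
  have hχ : 0 < fracChromatic G := h ▸ div_pos hn hα
  have hlow : ∀ x ∈ vertexPacking G, (∀ v, 0 < x v) →
      Real.logb 2 (fracChromatic G) ≤
        -(1 / (Fintype.card V : ℝ)) * ∑ v, Real.logb 2 (x v) := fun x hx hpos =>
    h ▸ logb_card_div_indepNum_le hx hpos
  have hlb : Real.logb 2 (fracChromatic G) ∈ lowerBounds {x | ∃ a ∈ vertexPacking G,
      (∀ v, 0 < 1 / (Fintype.card V : ℝ) → 0 < a v) ∧
      x = ∑ v, 1 / (Fintype.card V : ℝ) * Real.logb 2 (1 / a v)} := by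
    rintro _ ⟨a, ha, hpos, rfl⟩
    simpa [Finset.mul_sum] using hlow a ha fun v => hpos v (by positivity)
  have hpos_cover : ∀ w : Finset V → ℝ, (∀ I, 0 ≤ w I) →
      (∀ v : V, 1 ≤ ∑ I ∈ Finset.univ.filter (fun I : Finset V => v ∈ I), w I) →
      0 < ∑ I, w I := fun w hw hcov =>
    (zero_lt_one.trans_le (hcov (Classical.arbitrary V))).trans_le
      (Finset.sum_le_sum_of_subset_of_nonneg (Finset.filter_subset _ _) fun I _ _ => hw I)
  have hne : {x | ∃ w : Finset V → ℝ, (∀ I, 0 ≤ w I) ∧ (∀ I, w I ≠ 0 → IsIndepSet G I) ∧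
      (∀ v : V, 1 ≤ ∑ I ∈ Finset.univ.filter (fun I : Finset V => v ∈ I), w I) ∧
      x = ∑ I : Finset V, w I}.Nonempty := by
    by_contra hempty
    rw [fracChromatic, Set.not_nonempty_iff_eq_empty.mp hempty, Real.sInf_empty] at hχ
    exact lt_irrefl _ hχ
  refine ⟨le_antisymm ?_ (le_csInf ?_ hlb), by rw [h], hlow⟩
  · rw [Real.le_logb_iff_rpow_le one_lt_two hχ]
    refine le_csInf hne ?_
    rintro _ ⟨w, hw, hind, hcov, rfl⟩
    have hT := hpos_cover w hw hcov
    rw [← Real.le_logb_iff_rpow_le one_lt_two hT]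
    exact graphEntropy_uniform_le_logb_of_cover hw hind hcov hT ⟨_, hlb⟩
  · obtain ⟨_, w, hw, hind, hcov, -⟩ := hne
    have hT := hpos_cover w hw hcov
    obtain ⟨a, ha, hle⟩ := exists_mem_vertexPacking_of_cover hw hind hcov hT
    exact ⟨_, a, ha, fun v _ => (one_div_pos.mpr hT).trans_le (hle v), rfl⟩
end
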